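/- ∫_0^1 f(-q^5)^2 · f(-q)^2 · q^{-1/2} dq = (2/5^{3/4}) · K(1/2 − 11/(10√5)), where K(m) := ∫_0^{π/2} (1 − m·sin²θ)^{-1/2} dθ. -/

import Mathlib

open MeasureTheory Real

/-- Euler's product `f(-q) = ∏_{n=1}^∞ (1 - qⁿ)`. -/
noncomputable def eulerF (q : ℝ) : ℝ := ∏' n : ℕ, (1 - q ^ (n + 1))

/-- Complete elliptic integral of the first kind, parameter convention:
`K(m) = ∫_0^{π/2} (1 - m sin²θ)^{-1/2} dθ`. -/
noncomputable def ellipticK (m : ℝ) : ℝ :=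
  ∫ θ in (0 : ℝ)..(π / 2), (Real.sqrt (1 - m * Real.sin θ ^ 2))⁻¹


open Filter Topology Finset

section QSeries

variable {𝕜 : Type*} [RCLike 𝕜] {q : 𝕜}

/-- The triangular number `n (n + 1) / 2`, for an integer `n`. -/
def tri (n : ℤ) : ℤ := n * (n + 1) / 2

lemma two_mul_tri (n : ℤ) : 2 * tri n = n * (n + 1) :=
  Int.mul_ediv_cancel' (Int.even_mul_succ_self n).two_dvd

/-- The finite product `(q; q)_n`. -/
def eulerPartial (q : 𝕜) (n : ℕ) : 𝕜 := ∏ k ∈ range n, (1 - q ^ (k + 1))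

/-- Euler's product over a real or complex field. -/
noncomputable def eulerProd (q : 𝕜) : 𝕜 := ∏' n : ℕ, (1 - q ^ (n + 1))

/-- The Gaussian binomial coefficients, defined by their Pascal recursion. -/
def gaussBinom (q : 𝕜) : ℕ → ℕ → 𝕜
  | 0, 0 => 1
  | 0, _ + 1 => 0
  | _ + 1, 0 => 1
  | N + 1, j + 1 => gaussBinom q N (j + 1) + q ^ (N - j) * gaussBinom q N j

lemma gaussBinom_zero_right (q : 𝕜) (N : ℕ) : gaussBinom q N 0 = 1 := by
  cases N <;> rfl

lemma gaussBinom_eq_zero_of_lt (q : 𝕜) {N j : ℕ} (h : N < j) : gaussBinom q N j = 0 := by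
  induction N generalizing j with
  | zero =>
    obtain ⟨k, rfl⟩ : ∃ k, j = k + 1 := ⟨j - 1, by omega⟩
    rfl
  | succ N ih =>
    obtain ⟨k, rfl⟩ : ∃ k, j = k + 1 := ⟨j - 1, by omega⟩
    rw [gaussBinom, ih (by omega), ih (by omega), mul_zero, add_zero]

lemma gaussBinom_mul (q : 𝕜) (a b : ℕ) :
    gaussBinom q (a + b) a * (eulerPartial q a * eulerPartial q b) = eulerPartial q (a + b) := by
  obtain ⟨N, hN⟩ : ∃ N, N = a + b := ⟨_, rfl⟩
  induction N generalizing a b with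
  | zero =>
    obtain ⟨rfl, rfl⟩ : a = 0 ∧ b = 0 := by omega
    simp [gaussBinom, eulerPartial]
  | succ N ih =>
    rcases a with _ | a
    · simp [gaussBinom_zero_right, eulerPartial]
    · rcases b with _ | b
      · have h := ih a 0 (by omega)
        simp only [add_zero] at h ⊢
        rw [gaussBinom, gaussBinom_eq_zero_of_lt q (Nat.lt_succ_self a)]
        simp only [eulerPartial, prod_range_succ, range_zero, prod_empty, Nat.sub_self] at h ⊢
        linear_combination (1 - q ^ (a + 1)) * h
      · have h1 := ih (a + 1) b (by omega)
        have h2 := ih a (b + 1) (by omega)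
        rw [show a + 1 + (b + 1) = (a + b + 1) + 1 by ring, gaussBinom]
        rw [show a + 1 + b = a + b + 1 by ring] at h1
        rw [show a + (b + 1) = a + b + 1 by ring] at h2
        rw [show a + b + 1 - a = b + 1 by omega]
        have e1 : eulerPartial q (a + 1) = eulerPartial q a * (1 - q ^ (a + 1)) :=
          prod_range_succ _ _
        have e2 : eulerPartial q (b + 1) = eulerPartial q b * (1 - q ^ (b + 1)) :=
          prod_range_succ _ _
        have e3 : eulerPartial q (a + b + 1 + 1) =
          eulerPartial q (a + b + 1) * (1 - q ^ (a + b + 1 + 1)) := prod_range_succ _ _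
        rw [e3]
        rw [e1] at h1 ⊢
        rw [e2] at h2 ⊢
        linear_combination (1 - q ^ (b + 1)) * h1 + q ^ (b + 1) * (1 - q ^ (a + 1)) * h2

lemma prod_one_add_mul_pow (q x : 𝕜) (N : ℕ) :
    ∏ k ∈ range N, (1 + x * q ^ k) =
      ∑ j ∈ range (N + 1), gaussBinom q N j * q ^ (j.choose 2) * x ^ j := by
  induction N with
  | zero => simp [gaussBinom]
  | succ N ih =>
    rw [prod_range_succ, ih, sum_range_succ' _ (N + 1)]
    have h : ∀ j ∈ range (N + 1),
        gaussBinom q (N + 1) (j + 1) * q ^ ((j + 1).choose 2) * x ^ (j + 1) =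
        gaussBinom q N (j + 1) * q ^ ((j + 1).choose 2) * x ^ (j + 1) +
          gaussBinom q N j * q ^ (j.choose 2) * x ^ j * (x * q ^ N) := by
      intro j hj
      have hj : j ≤ N := by simpa [Nat.lt_succ_iff] using hj
      have hq : q ^ N = q ^ (N - j) * q ^ j := by rw [← pow_add, Nat.sub_add_cancel hj]
      rw [gaussBinom, hq, Nat.choose_succ_succ' j 1, Nat.choose_one_right, pow_add]
      ring
    rw [sum_congr rfl h, sum_add_distrib, ← sum_mul]
    have h2 : ∑ j ∈ range (N + 1), gaussBinom q N j * q ^ (j.choose 2) * x ^ j =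
        ∑ j ∈ range (N + 1), gaussBinom q N (j + 1) * q ^ ((j + 1).choose 2) * x ^ (j + 1) + 1 := by
      rw [sum_range_succ' _ N, sum_range_succ _ N, gaussBinom_eq_zero_of_lt q (Nat.lt_succ_self N)]
      simp [gaussBinom_zero_right]
    rw [gaussBinom_zero_right]
    simp only [Nat.choose_zero_succ, pow_zero, mul_one]
    linear_combination h2

/-- The coefficient of `z ^ i * q ^ tri i` in the finite Jacobi triple product. -/
def tripleCoeff (q : 𝕜) (n : ℕ) (i : ℤ) : 𝕜 :=
  if -(n : ℤ) ≤ i ∧ i ≤ n then gaussBinom q (2 * n) (n + i).toNat else 0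

lemma prod_zpow_shift (hq : q ≠ 0) {z : 𝕜} (hz : z ≠ 0) (n : ℕ) :
    ∏ k ∈ range (2 * n), (1 + z * q ^ (1 - n : ℤ) * q ^ k) =
      z ^ n * q ^ (-tri (n - 1)) *
        ∏ k ∈ range n, ((1 + z * q ^ (k + 1)) * (1 + z⁻¹ * q ^ k)) := by
  have h1 : ∏ k ∈ range n, (1 + z * q ^ (1 - n : ℤ) * q ^ (n + k)) =
      ∏ k ∈ range n, (1 + z * q ^ (k + 1)) := by
    refine prod_congr rfl fun k _ ↦ ?_
    rw [mul_assoc, ← zpow_natCast q (n + k), ← zpow_natCast q (k + 1), ← zpow_add₀ hq]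
    congr 3
    push_cast; ring
  have h2 : ∏ k ∈ range n, (1 + z * q ^ (1 - n : ℤ) * q ^ k) =
      ∏ k ∈ range n, (1 + z * q ^ (-k : ℤ)) := by
    rw [← prod_range_reflect]
    refine prod_congr rfl fun k hk ↦ ?_
    have hk : k < n := by simpa using hk
    rw [mul_assoc, ← zpow_natCast q (n - 1 - k), ← zpow_add₀ hq]
    congr 3
    omega
  have h3 : ∀ n : ℕ, ∏ k ∈ range n, (1 + z * q ^ (-k : ℤ)) =
      z ^ n * q ^ (-tri (n - 1)) * ∏ k ∈ range n, (1 + z⁻¹ * q ^ k) := by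
    intro n
    induction n with
    | zero => simp [tri]
    | succ n ih =>
      have ht : -tri ((n + 1 : ℕ) - 1 : ℤ) = -tri (n - 1) + -n := by
        have := two_mul_tri n
        have := two_mul_tri (n - 1)
        push_cast
        rw [show ((n : ℤ) + 1 - 1) = n by ring]
        linarith
      rw [prod_range_succ, prod_range_succ, ih, ht, zpow_add₀ hq, zpow_neg q n, zpow_natCast]
      field_simp
      ring
  rw [two_mul, prod_range_add, h1, h2, h3, prod_mul_distrib]
  ring

lemma finite_triple_product (hq : q ≠ 0) {z : 𝕜} (hz : z ≠ 0) (n : ℕ) :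
    ∏ k ∈ range n, ((1 + z * q ^ (k + 1)) * (1 + z⁻¹ * q ^ k)) =
      ∑ i ∈ Icc (-n : ℤ) n, tripleCoeff q n i * (z ^ i * q ^ tri i) := by
  have h := prod_zpow_shift hq hz n
  rw [prod_one_add_mul_pow] at h
  have h0 : z ^ n * q ^ (-tri (n - 1 : ℤ)) ≠ 0 := by positivity
  rw [← mul_right_inj' h0, ← h, mul_sum]
  refine sum_nbij' (fun j ↦ (j : ℤ) - n) (fun i ↦ (n + i).toNat) ?_ ?_ ?_ ?_ ?_
  · intro j hj; simp at hj ⊢; omega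
  · intro i hi; simp at hi ⊢; omega
  · intro j hj; simp at hj ⊢
  · intro i hi; simp at hi ⊢; omega
  · intro j hj
    simp at hj
    rw [tripleCoeff, if_pos (by omega), show ((n : ℤ) + (j - n)).toNat = j by omega]
    have e1 : z ^ n * z ^ ((j : ℤ) - n) = z ^ j := by
      rw [← zpow_natCast, ← zpow_natCast, ← zpow_add₀ hz]; congr 1; ring
    have hc : ((j.choose 2 : ℕ) : ℤ) * 2 = j * (j - 1) := by
      rcases j with _ | j
      · simp
      · have : (j + 1).choose 2 * 2 = (j + 1) * j := by
          rw [Nat.choose_two_right, Nat.div_mul_cancel]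
          · simp
          · simpa [mul_comm] using (Nat.even_mul_succ_self j).two_dvd
        push_cast
        have := congrArg (Nat.cast (R := ℤ)) this
        push_cast at this
        rw [this]; ring
    have e2 : q ^ (-tri (n - 1)) * q ^ tri ((j : ℤ) - n) =
        q ^ (j.choose 2) * (q ^ (1 - n : ℤ)) ^ j := by
      rw [← zpow_natCast, ← zpow_natCast, ← zpow_mul, ← zpow_add₀ hq, ← zpow_add₀ hq]
      congr 1
      have := two_mul_tri (n - 1)
      have := two_mul_tri ((j : ℤ) - n)
      linarith
    rw [mul_pow]
    linear_combination (-gaussBinom q (2 * n) j * z ^ n * z ^ ((j : ℤ) - n)) * e2 -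
      gaussBinom q (2 * n) j * q ^ (j.choose 2) * (q ^ (1 - n : ℤ)) ^ j * e1

lemma multipliable_one_sub_pow_succ (hq : ‖q‖ < 1) :
    Multipliable fun n : ℕ ↦ 1 - q ^ (n + 1) := by
  simp_rw [sub_eq_add_neg]
  apply multipliable_one_add_of_summable
  simpa using (summable_nat_add_iff 1).mpr (summable_geometric_of_lt_one (norm_nonneg _) hq)

lemma tendsto_eulerPartial (hq : ‖q‖ < 1) :
    Tendsto (eulerPartial q) atTop (𝓝 (eulerProd q)) :=
  (multipliable_one_sub_pow_succ hq).hasProd.tendsto_prod_nat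

lemma one_sub_pow_succ_ne_zero (hq : ‖q‖ < 1) (n : ℕ) : 1 - q ^ (n + 1) ≠ 0 := by
  intro h
  have h1 : ‖q ^ (n + 1)‖ < 1 := by
    rw [norm_pow]; exact pow_lt_one₀ (norm_nonneg _) hq (by omega)
  rw [← sub_eq_zero.mp h] at h1
  simp at h1

lemma eulerPartial_ne_zero (hq : ‖q‖ < 1) (n : ℕ) : eulerPartial q n ≠ 0 :=
  prod_ne_zero_iff.mpr fun k _ ↦ one_sub_pow_succ_ne_zero hq k

lemma eulerProd_ne_zero (hq : ‖q‖ < 1) : eulerProd q ≠ 0 := by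
  have := tprod_one_add_ne_zero_of_summable (f := fun n : ℕ ↦ -q ^ (n + 1))
    (fun i ↦ by simpa [← sub_eq_add_neg] using one_sub_pow_succ_ne_zero hq i)
    (by simpa using
      (summable_nat_add_iff 1).mpr (summable_geometric_of_lt_one (norm_nonneg _) hq))
  simpa [← sub_eq_add_neg] using! this

lemma tripleCoeff_eq_div (hq : ‖q‖ < 1) {n : ℕ} {i : ℤ} (h1 : -(n : ℤ) ≤ i) (h2 : i ≤ n) :
    tripleCoeff q n i = eulerPartial q (2 * n) *
      (eulerPartial q (n + i).toNat)⁻¹ * (eulerPartial q (n - i).toNat)⁻¹ := by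
  rw [tripleCoeff, if_pos ⟨h1, h2⟩]
  have h := gaussBinom_mul q (n + i).toNat (n - i).toNat
  rw [show (n + i).toNat + (n - i).toNat = 2 * n by omega] at h
  rw [← h]
  have := eulerPartial_ne_zero hq (n + i).toNat
  have := eulerPartial_ne_zero hq (n - i).toNat
  field_simp

lemma exists_norm_tripleCoeff_le (hq : ‖q‖ < 1) : ∃ C, ∀ n i, ‖tripleCoeff q n i‖ ≤ C := by
  obtain ⟨a, ha⟩ := isBounded_iff_forall_norm_le.mp (Metric.isBounded_range_of_tendsto _
    (tendsto_eulerPartial hq))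
  obtain ⟨b, hb⟩ := isBounded_iff_forall_norm_le.mp (Metric.isBounded_range_of_tendsto _
    ((tendsto_eulerPartial hq).inv₀ (eulerProd_ne_zero hq)))
  have ha (n) : ‖eulerPartial q n‖ ≤ a := ha _ ⟨n, rfl⟩
  have hb (n) : ‖(eulerPartial q n)⁻¹‖ ≤ b := hb _ ⟨n, rfl⟩
  have ha0 : 0 ≤ a := (norm_nonneg _).trans (ha 0)
  have hb0 : 0 ≤ b := (norm_nonneg _).trans (hb 0)
  refine ⟨a * b * b, fun n i ↦ ?_⟩
  by_cases h : -(n : ℤ) ≤ i ∧ i ≤ n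
  · rw [tripleCoeff_eq_div hq h.1 h.2, norm_mul, norm_mul]
    gcongr
    exacts [ha _, hb _, hb _]
  · rw [tripleCoeff, if_neg h, norm_zero]; positivity

lemma tendsto_tripleCoeff (hq : ‖q‖ < 1) (i : ℤ) :
    Tendsto (fun n ↦ tripleCoeff q n i) atTop (𝓝 (eulerProd q)⁻¹) := by
  have h0 := eulerProd_ne_zero hq
  have hP := tendsto_eulerPartial hq
  have t1 : Tendsto (fun n : ℕ ↦ 2 * n) atTop atTop :=
    tendsto_atTop_mono (fun n ↦ by simp only [id]; omega) tendsto_id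
  have t2 (j : ℤ) : Tendsto (fun n : ℕ ↦ (n + j).toNat) atTop atTop := by
    refine tendsto_atTop.mpr fun b ↦ ?_
    filter_upwards [eventually_ge_atTop (b + j.natAbs)] with n hn
    omega
  have h := ((hP.comp t1).mul ((hP.comp (t2 i)).inv₀ h0)).mul ((hP.comp (t2 (-i))).inv₀ h0)
  rw [mul_inv_cancel₀ h0, one_mul] at h
  refine h.congr' ?_
  filter_upwards [eventually_ge_atTop i.natAbs] with n hn
  rw [tripleCoeff_eq_div hq (by omega) (by omega)]
  rfl

lemma tendsto_sum_tripleCoeff (hq : ‖q‖ < 1) {g : ℤ → 𝕜} (hg : Summable fun i ↦ ‖g i‖) :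
    Tendsto (fun n : ℕ ↦ ∑ i ∈ Icc (-n : ℤ) n, tripleCoeff q n i * g i) atTop
      (𝓝 ((eulerProd q)⁻¹ * ∑' i, g i)) := by
  obtain ⟨C, hC⟩ := exists_norm_tripleCoeff_le hq
  have h (n : ℕ) : ∑ i ∈ Icc (-n : ℤ) n, tripleCoeff q n i * g i =
      ∑' i, tripleCoeff q n i * g i := by
    refine (tsum_eq_sum fun i hi ↦ ?_).symm
    rw [tripleCoeff, if_neg (by simpa using hi), zero_mul]
  simp_rw [h]
  rw [← tsum_mul_left]
  refine tendsto_tsum_of_dominated_convergence (hg.mul_left C)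
    (fun i ↦ (tendsto_tripleCoeff hq i).mul_const _) (.of_forall fun n i ↦ ?_)
  rw [norm_mul]
  gcongr
  exact hC n i

/-- **Jacobi triple product identity**, in terms of partial products. -/
theorem tendsto_triple_product (hq0 : q ≠ 0) (hq : ‖q‖ < 1) {z : 𝕜} (hz : z ≠ 0)
    (hs : Summable fun i : ℤ ↦ ‖z ^ i * q ^ tri i‖) :
    Tendsto (fun n ↦ ∏ k ∈ range n, ((1 + z * q ^ (k + 1)) * (1 + z⁻¹ * q ^ k))) atTop
      (𝓝 ((eulerProd q)⁻¹ * ∑' i : ℤ, z ^ i * q ^ tri i)) := by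
  simp_rw [finite_triple_product hq0 hz]
  exact tendsto_sum_tripleCoeff hq hs

lemma sum_tripleCoeff_deriv (hq : q ≠ 0) (n : ℕ) :
    ∑ i ∈ Icc (-(n + 1 : ℕ) : ℤ) (n + 1 : ℕ), tripleCoeff q (n + 1) i * (i * (-1) ^ i * q ^ tri i) =
      eulerPartial q (n + 1) * eulerPartial q n := by
  have hR : HasDerivAt (fun z : 𝕜 ↦ ∑ i ∈ Icc (-(n + 1 : ℕ) : ℤ) (n + 1 : ℕ),
      tripleCoeff q (n + 1) i * (z ^ i * q ^ tri i))
      (∑ i ∈ Icc (-(n + 1 : ℕ) : ℤ) (n + 1 : ℕ),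
        tripleCoeff q (n + 1) i * (i * (-1) ^ (i - 1) * q ^ tri i)) (-1) := by
    refine HasDerivAt.fun_sum fun i _ ↦ ?_
    exact ((hasDerivAt_zpow i (-1 : 𝕜) (by simp)).mul_const _).const_mul _
  set G : 𝕜 → 𝕜 := fun z ↦ (∏ k ∈ range (n + 1), (1 + z * q ^ (k + 1))) *
    ∏ k ∈ range n, (1 + z⁻¹ * q ^ (k + 1)) with hG
  have hGd : DifferentiableAt 𝕜 G (-1) := by
    have h1 (k : ℕ) : DifferentiableAt 𝕜 (fun z : 𝕜 ↦ 1 + z * q ^ k) (-1) := by fun_prop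
    have h2 (k : ℕ) : DifferentiableAt 𝕜 (fun z : 𝕜 ↦ 1 + z⁻¹ * q ^ k) (-1) := by
      have : (-1 : 𝕜) ≠ 0 := by simp
      fun_prop (disch := assumption)
    exact (DifferentiableAt.fun_finsetProd fun k _ ↦ h1 _).mul
      (DifferentiableAt.fun_finsetProd fun k _ ↦ h2 _)
  have hL : HasDerivAt (fun z : 𝕜 ↦ (1 + z⁻¹) * G z) (-G (-1)) (-1) := by
    have h1 : HasDerivAt (fun z : 𝕜 ↦ 1 + z⁻¹) (-1) (-1) := by
      simpa using (hasDerivAt_inv (show (-1 : 𝕜) ≠ 0 by simp)).const_add 1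
    have h := h1.mul hGd.hasDerivAt
    simpa [inv_neg] using! h
  have heq : (fun z : 𝕜 ↦ (1 + z⁻¹) * G z) =ᶠ[𝓝 (-1)] fun z : 𝕜 ↦
      ∑ i ∈ Icc (-(n + 1 : ℕ) : ℤ) (n + 1 : ℕ), tripleCoeff q (n + 1) i * (z ^ i * q ^ tri i) := by
    filter_upwards [eventually_ne_nhds (show (-1 : 𝕜) ≠ 0 by simp)] with z hz
    rw [← finite_triple_product hq hz, prod_mul_distrib, prod_range_succ' (fun k ↦ 1 + z⁻¹ * q ^ k)]
    simp only [hG, pow_zero, mul_one]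
    ring
  have h := (hL.congr_of_eventuallyEq heq.symm).unique hR
  have hGv : G (-1) = eulerPartial q (n + 1) * eulerPartial q n := by
    simp [hG, eulerPartial, inv_neg, ← sub_eq_add_neg]
  rw [← hGv, ← neg_inj, h, ← sum_neg_distrib]
  refine sum_congr rfl fun i _ ↦ ?_
  rw [zpow_sub_one₀ (by simp)]
  simp [inv_neg]

/-- **Jacobi's identity** for the cube of Euler's product. -/
theorem eulerProd_cube (hq0 : q ≠ 0) (hq : ‖q‖ < 1)
    (hs : Summable fun i : ℤ ↦ ‖(i : 𝕜) * (-1) ^ i * q ^ tri i‖) :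
    ∑' i : ℤ, (i : 𝕜) * (-1) ^ i * q ^ tri i = eulerProd q ^ 3 := by
  have hP := tendsto_eulerPartial hq
  have h1 := (tendsto_sum_tripleCoeff hq hs).comp (tendsto_add_atTop_nat 1)
  have h2 := (hP.comp (tendsto_add_atTop_nat 1)).mul hP
  have h := tendsto_nhds_unique (h1.congr fun n ↦ by
    simpa using! sum_tripleCoeff_deriv hq0 n) h2
  have h0 := eulerProd_ne_zero hq
  field_simp at h
  linear_combination h

end QSeries

section Products

variable {𝕜 : Type*} [RCLike 𝕜] {q : 𝕜}

lemma summable_abs_pow_mul_zpow {r : ℝ} (hr0 : 0 < r) (hr : r < 1) (k : ℕ) {e : ℤ → ℤ} {c : ℤ}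
    (he : ∀ i, |i| ≤ e i + c) : Summable fun i : ℤ ↦ |(i : ℝ)| ^ k * r ^ e i := by
  have h0 : Summable fun n : ℕ ↦ (n : ℝ) ^ k * r ^ n :=
    summable_pow_mul_geometric_of_norm_lt_one k (by rwa [Real.norm_of_nonneg hr0.le])
  have h1 : Summable fun i : ℤ ↦ |(i : ℝ)| ^ k * r ^ |i| :=
    .of_nat_of_neg (by simpa using h0) (by simpa using h0)
  refine .of_nonneg_of_le (fun i ↦ by positivity) (fun i ↦ ?_) (h1.mul_right (r ^ (-c)))
  rw [mul_assoc, ← zpow_add₀ hr0.ne']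
  exact mul_le_mul_of_nonneg_left
    (zpow_le_zpow_right_of_le_one₀ hr0 hr.le (by linarith [he i])) (by positivity)

lemma summable_norm_pow_mul_zpow (hq0 : q ≠ 0) (hq : ‖q‖ < 1) (k : ℕ) {e : ℤ → ℤ} {c : ℤ}
    (he : ∀ i, |i| ≤ e i + c) : Summable fun i : ℤ ↦ ‖(i : 𝕜) ^ k * ((-1) ^ i * q ^ e i)‖ := by
  refine (summable_abs_pow_mul_zpow (norm_pos_iff.mpr hq0) hq k he).congr fun i ↦ ?_
  have : ‖(i : 𝕜)‖ = |(i : ℝ)| := by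
    rw [← RCLike.ofReal_intCast, RCLike.norm_ofReal]
  simp [norm_mul, norm_pow, norm_zpow, this]

lemma abs_le_tri_add_one (i : ℤ) : |i| ≤ tri i + 1 := by
  have := two_mul_tri i
  rcases abs_cases i with ⟨h, h'⟩ | ⟨h, h'⟩ <;> rw [h]
  · nlinarith [sq_nonneg (i - 1)]
  · rcases le_or_gt i (-2) with h2 | h2
    · nlinarith [mul_nonneg (show 0 ≤ -i - 1 by linarith) (show 0 ≤ -i - 2 by linarith)]
    · obtain rfl : i = -1 := by omega
      simp [tri]

lemma abs_le_five_mul_tri_sub (i : ℤ) : |i| ≤ 5 * tri i - i ∧ |i| ≤ 5 * tri i - 2 * i := by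
  have := two_mul_tri i
  rcases abs_cases i with ⟨h, h'⟩ | ⟨h, h'⟩ <;> rw [h] <;> constructor <;>
    nlinarith [Int.le_self_sq i]

/-- The theta series `∑ (-1)ᵐ q ^ (m (5 m + 1) / 2)`. -/
noncomputable def thetaA (q : 𝕜) : 𝕜 := ∑' m : ℤ, (-1) ^ m * q ^ (5 * tri m - 2 * m)

/-- The theta series `∑ (-1)ⁿ q ^ (n (5 n + 3) / 2)`. -/
noncomputable def thetaB (q : 𝕜) : 𝕜 := ∑' n : ℤ, (-1) ^ n * q ^ (5 * tri n - n)

lemma summable_thetaA (hq0 : q ≠ 0) (hq : ‖q‖ < 1) (k : ℕ) :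
    Summable fun i : ℤ ↦ ‖(i : 𝕜) ^ k * ((-1) ^ i * q ^ (5 * tri i - 2 * i))‖ :=
  summable_norm_pow_mul_zpow hq0 hq k (c := 0) fun i ↦ by simpa using (abs_le_five_mul_tri_sub i).2

lemma summable_thetaB (hq0 : q ≠ 0) (hq : ‖q‖ < 1) (k : ℕ) :
    Summable fun i : ℤ ↦ ‖(i : 𝕜) ^ k * ((-1) ^ i * q ^ (5 * tri i - i))‖ :=
  summable_norm_pow_mul_zpow hq0 hq k (c := 0) fun i ↦ by simpa using (abs_le_five_mul_tri_sub i).1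

lemma summable_tri (hq0 : q ≠ 0) (hq : ‖q‖ < 1) (k : ℕ) :
    Summable fun i : ℤ ↦ ‖(i : 𝕜) ^ k * ((-1) ^ i * q ^ tri i)‖ :=
  summable_norm_pow_mul_zpow hq0 hq k abs_le_tri_add_one

lemma norm_pow_lt_one (hq : ‖q‖ < 1) {n : ℕ} (hn : n ≠ 0) : ‖q ^ n‖ < 1 := by
  rw [norm_pow]; exact pow_lt_one₀ (norm_nonneg _) hq hn

lemma tendsto_thetaA (hq0 : q ≠ 0) (hq : ‖q‖ < 1) :
    Tendsto (fun n ↦ ∏ k ∈ range n, ((1 - q ^ (5 * k + 3)) * (1 - q ^ (5 * k + 2)))) atTop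
      (𝓝 ((eulerProd (q ^ 5))⁻¹ * thetaA q)) := by
  have e (i : ℤ) : (-q ^ (-2 : ℤ)) ^ i * (q ^ 5) ^ tri i = (-1) ^ i * q ^ (5 * tri i - 2 * i) := by
    rw [neg_eq_neg_one_mul, mul_zpow, ← zpow_natCast q 5, ← zpow_mul, ← zpow_mul, mul_assoc,
      ← zpow_add₀ hq0]
    congr 2; push_cast; ring
  have h := tendsto_triple_product (pow_ne_zero 5 hq0) (norm_pow_lt_one hq (by norm_num))
    (z := -q ^ (-2 : ℤ)) (by simpa using hq0)
    (by simpa only [e, pow_zero, one_mul] using summable_thetaA hq0 hq 0)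
  simp_rw [e] at h
  refine h.congr fun n ↦ prod_congr rfl fun k _ ↦ ?_
  congr 1
  · rw [pow_succ]; field_simp; ring
  · rw [inv_neg]; field_simp; ring

lemma tendsto_thetaB (hq0 : q ≠ 0) (hq : ‖q‖ < 1) :
    Tendsto (fun n ↦ ∏ k ∈ range n, ((1 - q ^ (5 * k + 4)) * (1 - q ^ (5 * k + 1)))) atTop
      (𝓝 ((eulerProd (q ^ 5))⁻¹ * thetaB q)) := by
  have e (i : ℤ) : (-q⁻¹) ^ i * (q ^ 5) ^ tri i = (-1) ^ i * q ^ (5 * tri i - i) := by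
    rw [neg_eq_neg_one_mul, mul_zpow, ← zpow_natCast q 5, ← zpow_mul, ← zpow_neg_one, ← zpow_mul,
      mul_assoc, ← zpow_add₀ hq0]
    congr 2; push_cast; ring
  have h := tendsto_triple_product (pow_ne_zero 5 hq0) (norm_pow_lt_one hq (by norm_num))
    (z := -q⁻¹) (by simpa using hq0)
    (by simpa only [e, pow_zero, one_mul] using summable_thetaB hq0 hq 0)
  simp_rw [e] at h
  refine h.congr fun n ↦ prod_congr rfl fun k _ ↦ ?_
  congr 1
  · rw [pow_succ]; field_simp; ring
  · rw [inv_neg, inv_inv]; ring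

lemma eulerPartial_five_mul (q : 𝕜) (n : ℕ) :
    eulerPartial q (5 * n) = ∏ k ∈ range n, ((1 - q ^ (5 * k + 1)) * (1 - q ^ (5 * k + 2)) *
      (1 - q ^ (5 * k + 3)) * (1 - q ^ (5 * k + 4)) * (1 - q ^ (5 * k + 5))) := by
  induction n with
  | zero => simp [eulerPartial]
  | succ n ih =>
    rw [prod_range_succ, ← ih, show 5 * (n + 1) = 5 * n + 1 + 1 + 1 + 1 + 1 by ring]
    simp only [eulerPartial, prod_range_succ]
    ring

lemma tendsto_eulerPartial_five_mul (hq : ‖q‖ < 1) :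
    Tendsto (fun n ↦ eulerPartial q (5 * n)) atTop (𝓝 (eulerProd q)) :=
  (tendsto_eulerPartial hq).comp (tendsto_atTop_mono (fun n ↦ by simp only [id]; omega) tendsto_id)

lemma thetaA_mul_thetaB (hq0 : q ≠ 0) (hq : ‖q‖ < 1) :
    thetaA q * thetaB q = eulerProd q * eulerProd (q ^ 5) := by
  have hq5 := norm_pow_lt_one hq (show 5 ≠ 0 by norm_num)
  have h := ((tendsto_thetaA hq0 hq).mul (tendsto_thetaB hq0 hq)).mul (tendsto_eulerPartial hq5)
  have h' := tendsto_nhds_unique (h.congr fun n ↦ ?_) (tendsto_eulerPartial_five_mul hq)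
  · have h0 := eulerProd_ne_zero hq5
    field_simp at h'
    linear_combination h'
  · rw [eulerPartial_five_mul, eulerPartial, ← prod_mul_distrib, ← prod_mul_distrib]
    refine prod_congr rfl fun k _ ↦ ?_
    rw [← pow_mul, show 5 * (k + 1) = 5 * k + 5 by ring]
    ring

lemma prod_sub_zeta_mul {ζ : 𝕜} (hζ : IsPrimitiveRoot ζ 5) (x y : 𝕜) :
    ∏ j ∈ range 5, (x - ζ ^ j * y) = x ^ 5 - y ^ 5 := by
  have hs := hζ.geom_sum_eq_zero (by norm_num)
  have h5 := hζ.pow_eq_one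
  rw [hζ.pow_sub_pow_eq_prod_sub_mul x y (by norm_num)]
  refine prod_bij (fun j _ ↦ ζ ^ j) (fun j _ ↦ ?_) (fun i hi j hj h ↦ ?_) (fun z hz ↦ ?_)
    (fun _ _ ↦ rfl)
  · rw [Polynomial.mem_nthRootsFinset (by norm_num)]
    rw [← pow_mul, mul_comm, pow_mul, h5, one_pow]
  · exact hζ.pow_inj (by simpa using hi) (by simpa using hj) h
  · rw [Polynomial.mem_nthRootsFinset (by norm_num)] at hz
    obtain ⟨i, hi, rfl⟩ := hζ.eq_pow_of_pow_eq_one hz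
    exact ⟨i, by simpa using hi, rfl⟩

lemma prod_eulerProd_zeta_mul {ζ : 𝕜} (hζ : IsPrimitiveRoot ζ 5) (hq : ‖q‖ < 1) :
    (∏ j ∈ range 5, eulerProd (ζ ^ j * q)) * eulerProd (q ^ 25) = eulerProd (q ^ 5) ^ 6 := by
  have hζ1 : ‖ζ‖ = 1 := (pow_eq_one_iff_of_nonneg (norm_nonneg ζ) (show 5 ≠ 0 by norm_num)).mp
    (by rw [← norm_pow, hζ.pow_eq_one, norm_one])
  have hj (j : ℕ) : ‖ζ ^ j * q‖ < 1 := by simpa [hζ1] using hq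
  have hq5 := norm_pow_lt_one hq (show 5 ≠ 0 by norm_num)
  have hq25 := norm_pow_lt_one hq (show 25 ≠ 0 by norm_num)
  have hc (m : ℕ) (hm : m.Coprime 5) : ∏ j ∈ range 5, (1 - (ζ ^ j * q) ^ m) = 1 - q ^ (5 * m) := by
    have := prod_sub_zeta_mul (hζ.pow_of_coprime m hm) 1 (q ^ m)
    rw [one_pow, ← pow_mul, mul_comm m] at this
    rw [← this]
    refine prod_congr rfl fun j _ ↦ ?_
    rw [mul_pow, ← pow_mul, ← pow_mul, mul_comm j]
  have hd (k j : ℕ) : 1 - (ζ ^ j * q) ^ (5 * k + 5) = 1 - q ^ (5 * k + 5) := by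
    rw [mul_pow, ← pow_mul, show j * (5 * k + 5) = 5 * (j * (k + 1)) by ring, pow_mul,
      hζ.pow_eq_one, one_pow, one_mul]
  have h1 := (tendsto_finsetProd (range 5) fun j _ ↦ tendsto_eulerPartial_five_mul (hj j)).mul
    (tendsto_eulerPartial hq25)
  have h2 := (tendsto_eulerPartial_five_mul hq5).mul ((tendsto_eulerPartial hq5).pow 5)
  rw [pow_succ' (eulerProd (q ^ 5)), tendsto_nhds_unique (h1.congr fun n ↦ ?_) h2]
  simp_rw [eulerPartial_five_mul]
  rw [Finset.prod_comm]
  simp_rw [eulerPartial, ← prod_pow]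
  rw [← prod_mul_distrib, ← prod_mul_distrib]
  refine prod_congr rfl fun k _ ↦ ?_
  simp_rw [prod_mul_distrib, hd]
  have hk (r : ℕ) (hr : r.Coprime 5) : (5 * k + r).Coprime 5 := by simpa using hr
  rw [hc _ (hk 1 (by norm_num)), hc _ (hk 2 (by norm_num)), hc _ (hk 3 (by norm_num)),
    hc _ (hk 4 (by norm_num))]
  simp only [prod_const, card_range, ← pow_mul]
  rw [show 5 * (k + 1) = 5 * k + 5 by ring, show 25 * (k + 1) = 5 * (5 * k + 5) by ring]
  ring

end Products

section Lattice

variable {𝕜 : Type*} [RCLike 𝕜] {q : 𝕜}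

/-- The general term `(-1)ᵃ q ^ (a (a + 1) / 2)` of Jacobi's series. -/
def triTerm (q : 𝕜) (a : ℤ) : 𝕜 := (-1) ^ a * q ^ tri a

/-- The general term of `thetaA`. -/
def termA (q : 𝕜) (m : ℤ) : 𝕜 := (-1) ^ m * q ^ (5 * tri m - 2 * m)

/-- The general term of `thetaB`. -/
def termB (q : 𝕜) (n : ℤ) : 𝕜 := (-1) ^ n * q ^ (5 * tri n - n)

lemma tri_neg_sub_one (a : ℤ) : tri (-a - 1) = tri a := by
  have := two_mul_tri a
  have := two_mul_tri (-a - 1)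
  linarith

lemma triTerm_neg_sub_one (q : 𝕜) (a : ℤ) : triTerm q (-a - 1) = -triTerm q a := by
  have h1 : (-1 : 𝕜) ≠ 0 := by simp
  have : ((-1 : 𝕜) ^ a)⁻¹ = (-1) ^ a := by rw [← inv_zpow, inv_neg, inv_one]
  rw [triTerm, triTerm, tri_neg_sub_one, zpow_sub₀ h1, zpow_neg, this]
  rw [zpow_one, div_neg, div_one, neg_mul]

lemma neg_one_zpow_congr {a b : ℤ} (h : Even (a - b)) : (-1 : 𝕜) ^ a = (-1) ^ b := by
  rw [← sub_add_cancel a b, zpow_add₀ (by simp), h.neg_one_zpow, one_mul]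

lemma triTerm_mul_triTerm (hq0 : q ≠ 0) (m n : ℤ) :
    triTerm q (2 * m + n) * triTerm q (m - 2 * n - 1) = -(termA q m * termB q n) := by
  have e : tri (2 * m + n) + tri (m - 2 * n - 1) = (5 * tri m - 2 * m) + (5 * tri n - n) := by
    have := two_mul_tri m
    have := two_mul_tri n
    have := two_mul_tri (2 * m + n)
    have := two_mul_tri (m - 2 * n - 1)
    linarith
  have s : (-1 : 𝕜) ^ (2 * m + n) * (-1) ^ (m - 2 * n - 1) = -((-1) ^ m * (-1) ^ n) := by
    rw [← zpow_add₀ (by simp), ← zpow_add₀ (by simp),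
      neg_one_zpow_congr (b := m + n + 1) ⟨m - n - 1, by ring⟩, zpow_add₀ (by simp)]
    simp
  rw [triTerm, triTerm, termA, termB, mul_mul_mul_comm, mul_mul_mul_comm ((-1) ^ m),
    ← zpow_add₀ hq0, ← zpow_add₀ hq0, e, s]
  ring

/-- The sum of `G` over the pairs `(a, b)` with `a - 2 b ≡ s + 2` modulo `5`. -/
noncomputable def classSum (G : ℤ × ℤ → 𝕜) (s : ℤ) : 𝕜 :=
  ∑' p : ℤ × ℤ, if 5 ∣ p.1 - 2 * p.2 - 2 - s then G p else 0

lemma tsum_eq_classSum (G : ℤ × ℤ → 𝕜) (s : ℤ) :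
    ∑' p : ℤ × ℤ, G (2 * p.1 + p.2 + s, p.1 - 2 * p.2 - 1) = classSum G s := by
  let f : ℤ × ℤ → ℤ × ℤ := fun p ↦ (2 * p.1 + p.2 + s, p.1 - 2 * p.2 - 1)
  have hf : Function.Injective f := by
    rintro ⟨a, b⟩ ⟨c, d⟩ h
    simp only [f, Prod.mk.injEq] at h ⊢
    omega
  refine (tsum_congr fun p ↦ ?_).trans
    (hf.tsum_eq (f := fun p ↦ if 5 ∣ p.1 - 2 * p.2 - 2 - s then G p else 0) ?_)
  · exact (if_pos (⟨p.2, by simp only [f]; ring⟩ : (5 : ℤ) ∣ _)).symm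
  · rintro ⟨a, b⟩ h
    have h : 5 ∣ a - 2 * b - 2 - s := by
      by_contra h'
      simp [h'] at h
    obtain ⟨y, hy⟩ := h
    refine ⟨(b + 2 * y + 1, y), ?_⟩
    simp only [f, Prod.mk.injEq]
    omega

lemma classSum_rotate {G : ℤ × ℤ → 𝕜} (hG : ∀ a b, G (-b - 1, a) = G (a, b)) {s t : ℤ}
    (h : 5 ∣ t - (3 * s + 3)) : classSum G t = classSum G s := by
  let e : ℤ × ℤ ≃ ℤ × ℤ :=
    ⟨fun p ↦ (-p.2 - 1, p.1), fun p ↦ (p.2, -p.1 - 1), fun p ↦ by ext <;> simp,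
      fun p ↦ by ext <;> simp⟩
  rw [classSum, classSum, ← e.tsum_eq]
  refine tsum_congr fun p ↦ ?_
  have h1 : (5 ∣ (e p).1 - 2 * (e p).2 - 2 - t) ↔ 5 ∣ p.1 - 2 * p.2 - 2 - s := by
    simp only [e, Equiv.coe_fn_mk]
    omega
  simp only [h1]
  congr 1
  exact hG p.1 p.2

lemma tsum_eq_sum_classSum {G : ℤ × ℤ → 𝕜} (hG : Summable G) :
    ∑' p, G p = ∑ s ∈ range 5, classSum G s := by
  simp_rw [classSum]
  rw [← Summable.tsum_finsetSum]
  · refine tsum_congr fun p ↦ ?_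
    have h : ∀ x : ℤ, G p = ∑ s ∈ range 5, if 5 ∣ x - (s : ℤ) then G p else 0 := by
      intro x
      rw [sum_eq_single_of_mem (x % 5).toNat (by simp; omega), if_pos (by omega)]
      intro s hs hne
      have : s < 5 := by simpa using hs
      rw [if_neg (by omega)]
    exact h _
  · intro s _
    refine .of_norm_bounded hG.norm fun p ↦ ?_
    split_ifs <;> simp

lemma summable_norm_triTerm (hq0 : q ≠ 0) (hq : ‖q‖ < 1) : Summable fun a ↦ ‖triTerm q a‖ := by
  simpa only [pow_zero, one_mul] using! summable_tri hq0 hq 0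

lemma summable_norm_intCast_mul_triTerm (hq0 : q ≠ 0) (hq : ‖q‖ < 1) :
    Summable fun a : ℤ ↦ ‖(a : 𝕜) * triTerm q a‖ := by
  simpa only [pow_one] using! summable_tri hq0 hq 1

lemma summable_norm_tri_mul_triTerm (hq0 : q ≠ 0) (hq : ‖q‖ < 1) :
    Summable fun a : ℤ ↦ ‖(tri a : 𝕜) * triTerm q a‖ := by
  have h := ((summable_tri hq0 hq 2).of_norm.add (summable_tri hq0 hq 1).of_norm).mul_left (1 / 2)
  refine h.norm.congr fun a ↦ ?_
  have h2 := congrArg (Int.cast (R := 𝕜)) (two_mul_tri a)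
  push_cast at h2
  rw [triTerm]
  congr 1
  linear_combination (-1 / 2 * ((-1) ^ a * q ^ tri a)) * h2

lemma summable_norm_odd_mul_triTerm (hq0 : q ≠ 0) (hq : ‖q‖ < 1) :
    Summable fun a : ℤ ↦ ‖(2 * a + 1 : 𝕜) * triTerm q a‖ := by
  refine (((summable_norm_intCast_mul_triTerm hq0 hq).of_norm.mul_left 2).add
    (summable_norm_triTerm hq0 hq).of_norm).norm.congr fun a ↦ ?_
  congr 1
  ring

lemma tsum_odd_mul_triTerm (hq0 : q ≠ 0) (hq : ‖q‖ < 1) :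
    ∑' a : ℤ, (2 * a + 1 : 𝕜) * triTerm q a = 2 * eulerProd q ^ 3 := by
  have h1 := summable_norm_intCast_mul_triTerm hq0 hq
  have h0 := summable_norm_triTerm hq0 hq
  have hz : ∑' a, triTerm q a = 0 := by
    have h : ∑' a, triTerm q a = -∑' a, triTerm q a := by
      conv_lhs => rw [← ((Equiv.neg ℤ).trans (Equiv.subRight 1)).tsum_eq]
      rw [← tsum_neg]
      exact tsum_congr fun a ↦ triTerm_neg_sub_one q a
    exact self_eq_neg.mp h
  have hs : Summable fun i : ℤ ↦ ‖(i : 𝕜) * (-1) ^ i * q ^ tri i‖ :=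
    h1.congr fun i ↦ by rw [triTerm, mul_assoc]
  rw [← eulerProd_cube hq0 hq hs, ← add_zero (2 * _), ← hz, ← tsum_mul_left,
    ← (hs.of_norm.mul_left 2).tsum_add h0.of_norm]
  refine tsum_congr fun a ↦ ?_
  rw [triTerm]
  ring

/-- The quadratic weight attached to a pair of triangular indices. -/
def quadWeight (p : ℤ × ℤ) : ℤ := 3 * (tri p.2 - tri p.1) - (2 * p.1 + 1) * (2 * p.2 + 1)

/-- The weighted double series whose class sums give the sixth power of Euler's product. -/
def quadTerm (q : 𝕜) (p : ℤ × ℤ) : 𝕜 := quadWeight p * (triTerm q p.1 * triTerm q p.2)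

lemma summable_quadTerm (hq0 : q ≠ 0) (hq : ‖q‖ < 1) : Summable (quadTerm q) := by
  have h0 := summable_norm_triTerm hq0 hq
  have h2 := summable_norm_tri_mul_triTerm hq0 hq
  have h1 := summable_norm_odd_mul_triTerm hq0 hq
  refine ((((summable_mul_of_summable_norm h0 h2).sub (summable_mul_of_summable_norm h2 h0)).mul_left
    3).sub (summable_mul_of_summable_norm h1 h1)).congr fun p ↦ ?_
  rw [quadTerm, quadWeight]
  push_cast
  ring

lemma tsum_quadTerm (hq0 : q ≠ 0) (hq : ‖q‖ < 1) :
    ∑' p, quadTerm q p = -4 * eulerProd q ^ 6 := by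
  have hs := summable_quadTerm hq0 hq
  have h1 := summable_norm_odd_mul_triTerm hq0 hq
  have hsw : ∑' p : ℤ × ℤ, quadTerm q p = ∑' p : ℤ × ℤ, quadTerm q p.swap := by
    rw [← (Equiv.prodComm ℤ ℤ).tsum_eq (quadTerm q)]
    simp only [Equiv.prodComm_apply]
  have hs' : Summable fun p : ℤ × ℤ ↦ quadTerm q p.swap := hs.prod_symm
  have h : ∑' p, quadTerm q p + ∑' p : ℤ × ℤ, quadTerm q p.swap =
      -2 * ((∑' a : ℤ, (2 * a + 1 : 𝕜) * triTerm q a) * ∑' a : ℤ, (2 * a + 1 : 𝕜) * triTerm q a) := by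
    rw [← hs.tsum_add hs', tsum_mul_tsum_of_summable_norm h1 h1, ← tsum_mul_left]
    refine tsum_congr fun p ↦ ?_
    simp only [quadTerm, quadWeight, Prod.fst_swap, Prod.snd_swap]
    push_cast
    ring
  rw [← hsw, tsum_odd_mul_triTerm hq0 hq] at h
  linear_combination h / 2

lemma quadTerm_rotate (q : 𝕜) (a b : ℤ) : quadTerm q (-b - 1, a) = quadTerm q (a, b) := by
  simp only [quadTerm, quadWeight, tri_neg_sub_one, triTerm_neg_sub_one]
  push_cast
  ring

lemma classSum_quadTerm_one (hq0 : q ≠ 0) : classSum (quadTerm q) 1 = 0 := by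
  rw [← tsum_eq_classSum]
  have key (x y : ℤ) : quadTerm q (2 * x + y + 1, x - 2 * y - 1) =
      25 * (tri y - tri x) * ((-1) ^ (x + y) * q ^ (5 * (tri x + tri y) + 1)) := by
    have hx := two_mul_tri x
    have hy := two_mul_tri y
    have h1 := two_mul_tri (2 * x + y + 1)
    have h2 := two_mul_tri (x - 2 * y - 1)
    have hw : quadWeight (2 * x + y + 1, x - 2 * y - 1) = 25 * (tri y - tri x) := by
      simp only [quadWeight]
      linarith
    have ht : tri (2 * x + y + 1) + tri (x - 2 * y - 1) = 5 * (tri x + tri y) + 1 := by linarith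
    rw [quadTerm, hw]
    simp only [triTerm]
    rw [mul_mul_mul_comm, ← zpow_add₀ hq0, ht, ← zpow_add₀ (by simp),
      neg_one_zpow_congr (a := _ + _) (b := x + y) ⟨x - y, by ring⟩]
    push_cast
    ring
  simp_rw [key]
  refine self_eq_neg.mp ?_
  conv_lhs => rw [← (Equiv.prodComm ℤ ℤ).tsum_eq]
  rw [← tsum_neg]
  refine tsum_congr fun p ↦ ?_
  simp only [Equiv.prodComm_apply, Prod.fst_swap, Prod.snd_swap, add_comm p.2, add_comm (tri p.2)]
  ring

lemma classSum_quadTerm_zero (hq0 : q ≠ 0) (hq : ‖q‖ < 1) :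
    classSum (quadTerm q) 0 = -eulerProd q ^ 6 := by
  have h := tsum_eq_sum_classSum (summable_quadTerm hq0 hq)
  have hr {s t : ℤ} (h : 5 ∣ t - (3 * s + 3)) := classSum_rotate (quadTerm_rotate q) h
  rw [tsum_quadTerm hq0 hq] at h
  simp only [sum_range_succ, range_zero, sum_empty, Nat.cast_zero, Nat.cast_one,
    Nat.cast_ofNat, classSum_quadTerm_one hq0] at h
  rw [hr (s := 2) (t := 4) (by norm_num), hr (s := 3) (t := 2) (by norm_num),
    hr (s := 0) (t := 3) (by norm_num)] at h
  linear_combination -h / 4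

lemma summable_norm_termA (hq0 : q ≠ 0) (hq : ‖q‖ < 1) : Summable fun m ↦ ‖termA q m‖ := by
  simpa only [pow_zero, one_mul] using! summable_thetaA hq0 hq 0

lemma summable_norm_termB (hq0 : q ≠ 0) (hq : ‖q‖ < 1) : Summable fun m ↦ ‖termB q m‖ := by
  simpa only [pow_zero, one_mul] using! summable_thetaB hq0 hq 0

lemma summable_norm_mul_termA (hq0 : q ≠ 0) (hq : ‖q‖ < 1) :
    Summable fun m : ℤ ↦ ‖((5 * tri m - 2 * m : ℤ) : 𝕜) * termA q m‖ := by
  have h := ((summable_thetaA hq0 hq 2).of_norm.mul_left (5 / 2)).add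
    ((summable_thetaA hq0 hq 1).of_norm.mul_left (1 / 2))
  refine h.norm.congr fun a ↦ ?_
  have h2 := congrArg (Int.cast (R := 𝕜)) (two_mul_tri a)
  push_cast at h2 ⊢
  rw [termA]
  congr 1
  linear_combination (-5 / 2 * ((-1) ^ a * q ^ (5 * tri a - 2 * a))) * h2

lemma summable_norm_mul_termB (hq0 : q ≠ 0) (hq : ‖q‖ < 1) :
    Summable fun m : ℤ ↦ ‖((5 * tri m - m : ℤ) : 𝕜) * termB q m‖ := by
  have h := ((summable_thetaB hq0 hq 2).of_norm.mul_left (5 / 2)).add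
    ((summable_thetaB hq0 hq 1).of_norm.mul_left (3 / 2))
  refine h.norm.congr fun a ↦ ?_
  have h2 := congrArg (Int.cast (R := 𝕜)) (two_mul_tri a)
  push_cast at h2 ⊢
  rw [termB]
  congr 1
  linear_combination (-5 / 2 * ((-1) ^ a * q ^ (5 * tri a - a))) * h2

/-- The sixth power of Euler's product as a Wronskian of `thetaA` and `thetaB`. -/
theorem wronskian_theta (hq0 : q ≠ 0) (hq : ‖q‖ < 1) :
    thetaA q * thetaB q + 5 * (thetaA q * ∑' n : ℤ, (5 * tri n - n : ℤ) * termB q n -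
      (∑' m : ℤ, (5 * tri m - 2 * m : ℤ) * termA q m) * thetaB q) = eulerProd q ^ 6 := by
  have hA := summable_norm_termA hq0 hq
  have hB := summable_norm_termB hq0 hq
  have hA' := summable_norm_mul_termA hq0 hq
  have hB' := summable_norm_mul_termB hq0 hq
  have eA : thetaA q = ∑' m, termA q m := rfl
  have eB : thetaB q = ∑' m, termB q m := rfl
  have s0 := summable_mul_of_summable_norm hA hB
  have s1 := summable_mul_of_summable_norm hA hB'
  have s2 := summable_mul_of_summable_norm hA' hB
  rw [eA, eB, tsum_mul_tsum_of_summable_norm hA hB, tsum_mul_tsum_of_summable_norm hA hB',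
    tsum_mul_tsum_of_summable_norm hA' hB, ← s1.tsum_sub s2, ← tsum_mul_left,
    ← s0.tsum_add ((s1.sub s2).mul_left 5), ← neg_inj, ← tsum_neg, ← classSum_quadTerm_zero hq0 hq,
    ← tsum_eq_classSum]
  refine tsum_congr fun ⟨m, n⟩ ↦ ?_
  have hx := two_mul_tri m
  have hy := two_mul_tri n
  have h1 := two_mul_tri (2 * m + n)
  have h2 := two_mul_tri (m - 2 * n - 1)
  have hw : quadWeight (2 * m + n, m - 2 * n - 1) =
      1 + 5 * (5 * tri n - n) - 5 * (5 * tri m - 2 * m) := by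
    simp only [quadWeight]
    linarith
  simp only [add_zero, quadTerm, hw, triTerm_mul_triTerm hq0]
  push_cast
  ring

/-- The part of Jacobi's series supported on a residue class modulo `5`. -/
noncomputable def residueSum (q : 𝕜) (r : ℤ) : 𝕜 :=
  ∑' a : ℤ, if 5 ∣ a - r then triTerm q a else 0

lemma residueSum_eq_tsum (q : 𝕜) (r : ℤ) : residueSum q r = ∑' k : ℤ, triTerm q (5 * k + r) := by
  have hf : Function.Injective fun k : ℤ ↦ 5 * k + r := fun a b h ↦ by simpa using h
  rw [residueSum, ← hf.tsum_eq]
  · exact tsum_congr fun k ↦ if_pos ⟨k, by ring⟩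
  · intro a h
    have h : 5 ∣ a - r := by
      by_contra h'
      simp [h'] at h
    obtain ⟨k, hk⟩ := h
    exact ⟨k, by simp only; omega⟩

lemma residueSum_reflect (q : 𝕜) {r s : ℤ} (h : 5 ∣ r + s + 1) :
    residueSum q s = -residueSum q r := by
  rw [residueSum, residueSum, ← ((Equiv.neg ℤ).trans (Equiv.subRight 1)).tsum_eq, ← tsum_neg]
  refine tsum_congr fun a ↦ ?_
  have h1 : (5 ∣ -a - 1 - s) ↔ 5 ∣ a - r := by omega
  simp only [Equiv.trans_apply, Equiv.neg_apply, Equiv.subRight_apply, h1, triTerm_neg_sub_one]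
  split_ifs <;> simp

lemma residueSum_congr (q : 𝕜) {r s : ℤ} (h : 5 ∣ r - s) : residueSum q r = residueSum q s := by
  refine tsum_congr fun a ↦ ?_
  have h1 : (5 ∣ a - r) ↔ 5 ∣ a - s := by omega
  simp only [h1]

lemma residueSum_zero (q : 𝕜) : residueSum q 0 = thetaA (q ^ 5) := by
  rw [residueSum_eq_tsum, thetaA]
  refine tsum_congr fun k ↦ ?_
  have e : tri (5 * k + 0) = 5 * (5 * tri k - 2 * k) := by
    have := two_mul_tri (5 * k + 0)
    have := two_mul_tri k
    linarith
  rw [triTerm, e, ← zpow_natCast q 5, ← zpow_mul,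
    neg_one_zpow_congr (b := k) ⟨2 * k, by ring⟩]
  rfl

lemma residueSum_one (hq0 : q ≠ 0) : residueSum q 1 = -(q * thetaB (q ^ 5)) := by
  rw [residueSum_eq_tsum, thetaB, ← tsum_mul_left, ← tsum_neg]
  refine tsum_congr fun k ↦ ?_
  have e : tri (5 * k + 1) = 1 + 5 * (5 * tri k - k) := by
    have := two_mul_tri (5 * k + 1)
    have := two_mul_tri k
    linarith
  rw [triTerm, e, ← zpow_natCast q 5, ← zpow_mul, zpow_add₀ hq0, zpow_add₀ (by simp),
    neg_one_zpow_congr (b := k) ⟨2 * k, by ring⟩]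
  simp only [zpow_one]
  push_cast
  ring

lemma classSum_triTerm (hq0 : q ≠ 0) (hq : ‖q‖ < 1) :
    classSum (fun p ↦ triTerm q p.1 * triTerm q p.2) 0 =
      ∑ r ∈ range 5, residueSum q (2 * r + 2) * residueSum q r := by
  have h0 := summable_norm_triTerm hq0 hq
  have hs (r : ℤ) : Summable fun a : ℤ ↦ ‖if 5 ∣ a - r then triTerm q a else 0‖ := by
    refine .of_nonneg_of_le (fun _ ↦ norm_nonneg _) (fun a ↦ ?_) h0
    split_ifs <;> simp
  simp_rw [residueSum, tsum_mul_tsum_of_summable_norm (hs _) (hs _)]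
  rw [← Summable.tsum_finsetSum fun r _ ↦ summable_mul_of_summable_norm (hs _) (hs _), classSum]
  refine tsum_congr fun p ↦ ?_
  rw [sum_eq_single_of_mem (p.2 % 5).toNat (by simp; omega)]
  · have h1 : (5 ∣ p.2 - (p.2 % 5).toNat) := by omega
    have h2 : (5 ∣ p.1 - (2 * (p.2 % 5).toNat + 2)) ↔ 5 ∣ p.1 - 2 * p.2 - 2 - 0 := by omega
    simp only [h1, h2, if_true, ite_mul, zero_mul]
  · intro s hs hne
    have : s < 5 := by simpa using hs
    have : ¬ (5 ∣ p.2 - (s : ℤ)) := by omega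
    rw [if_neg this, mul_zero]

/-- Quintic dissection of `thetaA q * thetaB q`. -/
theorem thetaA_mul_thetaB_dissection (hq0 : q ≠ 0) (hq : ‖q‖ < 1) :
    thetaA q * thetaB q = thetaA (q ^ 5) ^ 2 - q * thetaA (q ^ 5) * thetaB (q ^ 5) -
      q ^ 2 * thetaB (q ^ 5) ^ 2 := by
  have hA := summable_norm_termA hq0 hq
  have hB := summable_norm_termB hq0 hq
  have h := classSum_triTerm hq0 hq
  rw [← tsum_eq_classSum] at h
  simp only [add_zero, triTerm_mul_triTerm hq0, tsum_neg] at h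
  rw [← tsum_mul_tsum_of_summable_norm hA hB] at h
  have h2 : residueSum q 2 = 0 :=
    self_eq_neg.mp (residueSum_reflect q (r := 2) (s := 2) (by norm_num))
  simp only [sum_range_succ, range_zero, sum_empty, Nat.cast_zero, Nat.cast_one,
    Nat.cast_ofNat] at h
  norm_num at h
  rw [residueSum_congr q (r := 6) (s := 1) (by norm_num),
    residueSum_congr q (r := 8) (s := 3) (by norm_num),
    residueSum_congr q (r := 10) (s := 0) (by norm_num),
    residueSum_reflect q (r := 0) (s := 4) (by norm_num),
    residueSum_reflect q (r := 1) (s := 3) (by norm_num), h2, residueSum_zero,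
    residueSum_one hq0] at h
  change -(thetaA q * thetaB q) = _ at h
  linear_combination -h

end Lattice

section Quintic

lemma quintic_theta_of_isPrimitiveRoot {𝕜 : Type*} [RCLike 𝕜] {q ζ : 𝕜}
    (hζ : IsPrimitiveRoot ζ 5) (hq0 : q ≠ 0) (hq : ‖q‖ < 1) :
    (thetaA (q ^ 5) ^ 10 - 11 * q ^ 5 * thetaA (q ^ 5) ^ 5 * thetaB (q ^ 5) ^ 5 -
      q ^ 10 * thetaB (q ^ 5) ^ 10) * eulerProd (q ^ 25) = eulerProd (q ^ 5) ^ 11 := by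
  have hζ1 : ‖ζ‖ = 1 := (pow_eq_one_iff_of_nonneg (norm_nonneg ζ) (show 5 ≠ 0 by norm_num)).mp
    (by rw [← norm_pow, hζ.pow_eq_one, norm_one])
  have hj (j : ℕ) : ‖ζ ^ j * q‖ < 1 := by simpa [hζ1] using hq
  have hj0 (j : ℕ) : ζ ^ j * q ≠ 0 := mul_ne_zero (pow_ne_zero _ (hζ.ne_zero (by norm_num))) hq0
  have h5 := hζ.pow_eq_one
  have hpow (j : ℕ) : (ζ ^ j * q) ^ 5 = q ^ 5 := by
    rw [mul_pow, ← pow_mul, mul_comm j, pow_mul, h5, one_pow, one_mul]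
  have hs := hζ.geom_sum_eq_zero (by norm_num)
  simp only [sum_range_succ, range_zero, sum_empty] at hs
  obtain ⟨φ, ψ, hadd, hmul⟩ : ∃ φ ψ : 𝕜, φ + ψ = 1 ∧ φ * ψ = -1 := by
    refine ⟨-(ζ ^ 2 + ζ ^ 3), -(ζ + ζ ^ 4), ?_, ?_⟩
    · linear_combination -hs
    · linear_combination hs + (ζ + ζ ^ 2) * h5
  set a := thetaA (q ^ 5)
  set b := thetaB (q ^ 5)
  have hfac (j : ℕ) : eulerProd (ζ ^ j * q) * eulerProd (q ^ 5) =
      (a - ζ ^ j * (φ * q * b)) * (a - ζ ^ j * (ψ * q * b)) := by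
    have h := thetaA_mul_thetaB (hj0 j) (hj j)
    rw [thetaA_mul_thetaB_dissection (hj0 j) (hj j), hpow] at h
    rw [← h]
    linear_combination (a * b * ζ ^ j * q) * hadd - (ζ ^ j * q * b) ^ 2 * hmul
  have hprod := Finset.prod_congr (rfl : range 5 = range 5) fun j _ ↦ hfac j
  rw [prod_mul_distrib, prod_mul_distrib, prod_sub_zeta_mul hζ, prod_sub_zeta_mul hζ, prod_const,
    card_range] at hprod
  have hE := prod_eulerProd_zeta_mul hζ hq
  have hψ : ψ = 1 - φ := by linear_combination hadd
  have h5' : φ ^ 5 + ψ ^ 5 = 11 := by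
    subst hψ
    linear_combination (5 * (φ * (1 - φ)) - 10) * hmul
  have h5m : φ ^ 5 * ψ ^ 5 = -1 := by
    rw [← mul_pow, hmul]
    norm_num
  linear_combination (-eulerProd (q ^ 25)) * hprod + eulerProd (q ^ 5) ^ 5 * hE +
    eulerProd (q ^ 25) * (-q ^ 10 * b ^ 10 * h5m + a ^ 5 * b ^ 5 * q ^ 5 * h5')

lemma ofReal_thetaA (q : ℝ) : thetaA (q : ℂ) = (thetaA q : ℝ) := by
  simp only [thetaA, Complex.ofReal_tsum]
  push_cast
  rfl

lemma ofReal_thetaB (q : ℝ) : thetaB (q : ℂ) = (thetaB q : ℝ) := by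
  simp only [thetaB, Complex.ofReal_tsum]
  push_cast
  rfl

lemma ofReal_eulerProd {q : ℝ} (hq : ‖q‖ < 1) : eulerProd (q : ℂ) = (eulerProd q : ℝ) := by
  refine (tprod_congr fun n ↦ ?_).trans ((multipliable_one_sub_pow_succ hq).map_tprod
    Complex.ofRealHom Complex.continuous_ofReal).symm
  simp

/-- The quintic relation between `thetaA`, `thetaB` and Euler's product. -/
theorem quintic_theta {q : ℝ} (hq0 : 0 < q) (hq : q < 1) :
    (thetaA q ^ 10 - 11 * q * thetaA q ^ 5 * thetaB q ^ 5 - q ^ 2 * thetaB q ^ 10) *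
      eulerProd (q ^ 5) = eulerProd q ^ 11 := by
  obtain ⟨r, hr0, hr⟩ : ∃ r : ℝ, 0 < r ∧ r ^ 5 = q :=
    ⟨q ^ (1 / 5 : ℝ), by positivity, by rw [← Real.rpow_natCast, ← Real.rpow_mul hq0.le]; norm_num⟩
  have hr1 : r < 1 := by
    by_contra! h
    linarith [one_le_pow₀ h (n := 5)]
  have h := quintic_theta_of_isPrimitiveRoot (Complex.isPrimitiveRoot_exp 5 (by norm_num))
    (q := (r : ℂ)) (by exact_mod_cast hr0.ne') (by simpa [abs_of_pos hr0] using hr1)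
  have e10 : r ^ 10 = q ^ 2 := by rw [← hr]; ring
  have e25 : r ^ 25 = q ^ 5 := by rw [← hr]; ring
  have hn : ‖q‖ < 1 := by rwa [Real.norm_of_nonneg hq0.le]
  simp only [← Complex.ofReal_pow, e10, e25, hr, ofReal_thetaA, ofReal_thetaB,
    ofReal_eulerProd hn, ofReal_eulerProd (norm_pow_lt_one hn (show 5 ≠ 0 by norm_num))] at h
  exact_mod_cast h

end Quintic

section Derivative

lemma hasDerivAt_tsum_zpow {e : ℤ → ℤ} (he : ∀ i, 0 ≤ e i)
    (hs : ∀ r : ℝ, 0 < r → r < 1 → Summable fun i ↦ ‖(-1) ^ i * r ^ e i‖)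
    (hs' : ∀ r : ℝ, 0 < r → r < 1 → Summable fun i ↦ ‖(e i : ℝ) * ((-1) ^ i * r ^ e i)‖)
    {q : ℝ} (hq0 : 0 < q) (hq : q < 1) :
    HasDerivAt (fun x : ℝ ↦ ∑' i : ℤ, (-1) ^ i * x ^ e i)
      ((∑' i : ℤ, (e i : ℝ) * ((-1) ^ i * q ^ e i)) / q) q := by
  obtain ⟨r, hqr, hr⟩ := exists_between hq
  have hr0 := hq0.trans hqr
  have hmem : q ∈ Set.Ioo (q / 2) r := ⟨half_lt_self hq0, hqr⟩
  have hd : ∀ (i : ℤ), ∀ y ∈ Set.Ioo (q / 2) r, HasDerivAt (fun x : ℝ ↦ (-1) ^ i * x ^ e i)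
      ((e i : ℝ) * ((-1) ^ i * y ^ e i) / y) y := by
    intro i y hy
    have hy0 : y ≠ 0 := ((half_pos hq0).trans hy.1).ne'
    refine ((hasDerivAt_zpow (e i) y (.inl hy0)).const_mul ((-1) ^ i)).congr_deriv ?_
    rw [zpow_sub_one₀ hy0]
    ring
  have hb : ∀ (i : ℤ), ∀ y ∈ Set.Ioo (q / 2) r, ‖(e i : ℝ) * ((-1) ^ i * y ^ e i) / y‖ ≤
      ‖(e i : ℝ) * ((-1) ^ i * r ^ e i)‖ / (q / 2) := by
    intro i y hy
    have hy0 : 0 < y := (half_pos hq0).trans hy.1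
    rw [norm_div, Real.norm_of_nonneg hy0.le]
    simp only [norm_mul, norm_zpow, Real.norm_of_nonneg hy0.le, Real.norm_of_nonneg hr0.le]
    gcongr
    · exact zpow_le_zpow_left₀ (he i) hy0.le hy.2.le
    · exact hy.1.le
  have h := hasDerivAt_tsum_of_isPreconnected ((hs' r hr0 hr).div_const (q / 2)) isOpen_Ioo
    isPreconnected_Ioo hd hb hmem (hs q hq0 hq).of_norm hmem
  rwa [tsum_div_const] at h

lemma hasDerivAt_thetaA {q : ℝ} (hq0 : 0 < q) (hq : q < 1) :
    HasDerivAt thetaA ((∑' m : ℤ, ((5 * tri m - 2 * m : ℤ) : ℝ) * termA q m) / q) q :=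
  hasDerivAt_tsum_zpow (fun i ↦ (abs_nonneg i).trans (abs_le_five_mul_tri_sub i).2)
    (fun r h0 h ↦ summable_norm_termA h0.ne' (by rwa [Real.norm_of_nonneg h0.le]))
    (fun r h0 h ↦ summable_norm_mul_termA h0.ne' (by rwa [Real.norm_of_nonneg h0.le])) hq0 hq

lemma hasDerivAt_thetaB {q : ℝ} (hq0 : 0 < q) (hq : q < 1) :
    HasDerivAt thetaB ((∑' n : ℤ, ((5 * tri n - n : ℤ) : ℝ) * termB q n) / q) q :=
  hasDerivAt_tsum_zpow (fun i ↦ (abs_nonneg i).trans (abs_le_five_mul_tri_sub i).1)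
    (fun r h0 h ↦ summable_norm_termB h0.ne' (by rwa [Real.norm_of_nonneg h0.le]))
    (fun r h0 h ↦ summable_norm_mul_termB h0.ne' (by rwa [Real.norm_of_nonneg h0.le])) hq0 hq

lemma eulerPartial_pos {q : ℝ} (hq0 : 0 ≤ q) (hq : q < 1) (n : ℕ) : 0 < eulerPartial q n :=
  prod_pos fun k _ ↦ sub_pos.mpr (pow_lt_one₀ hq0 hq k.succ_ne_zero)

lemma eulerProd_pos {q : ℝ} (hq0 : 0 ≤ q) (hq : q < 1) : 0 < eulerProd q := by
  have hn : ‖q‖ < 1 := by rwa [Real.norm_of_nonneg hq0]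
  exact (ge_of_tendsto' (tendsto_eulerPartial hn) fun n ↦ (eulerPartial_pos hq0 hq n).le).lt_of_ne'
    (eulerProd_ne_zero hn)

/-- The fifth power of the Rogers–Ramanujan continued fraction, as a quotient of theta series. -/
noncomputable def thetaRatio (q : ℝ) : ℝ := q * thetaB q ^ 5 / thetaA q ^ 5

/-- The Hauptmodul `q (f(-q⁵) / f(-q))⁶` of level `5`. -/
noncomputable def hauptmodul (q : ℝ) : ℝ := q * eulerProd (q ^ 5) ^ 6 / eulerProd q ^ 6

lemma eulerProd_pow_five_pos {q : ℝ} (hq0 : 0 ≤ q) (hq : q < 1) : 0 < eulerProd (q ^ 5) :=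
  eulerProd_pos (pow_nonneg hq0 5) (pow_lt_one₀ hq0 hq (by norm_num))

lemma hauptmodul_pos {q : ℝ} (hq0 : 0 < q) (hq : q < 1) : 0 < hauptmodul q :=
  div_pos (mul_pos hq0 (pow_pos (eulerProd_pow_five_pos hq0.le hq) 6))
    (pow_pos (eulerProd_pos hq0.le hq) 6)

lemma thetaA_mul_thetaB_pos {q : ℝ} (hq0 : 0 < q) (hq : q < 1) : 0 < thetaA q * thetaB q := by
  rw [thetaA_mul_thetaB hq0.ne' (by rwa [Real.norm_of_nonneg hq0.le])]
  exact mul_pos (eulerProd_pos hq0.le hq) (eulerProd_pow_five_pos hq0.le hq)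

lemma thetaRatio_pos {q : ℝ} (hq0 : 0 < q) (hq : q < 1) : 0 < thetaRatio q := by
  have h := thetaA_mul_thetaB_pos hq0 hq
  have hA : thetaA q ≠ 0 := left_ne_zero_of_mul h.ne'
  have e : thetaRatio q = q * (thetaA q * thetaB q) ^ 5 / (thetaA q ^ 5) ^ 2 := by
    rw [thetaRatio]
    field_simp
  rw [e]
  positivity

lemma inv_thetaRatio_sub {q : ℝ} (hq0 : 0 < q) (hq : q < 1) :
    (thetaRatio q)⁻¹ - 11 - thetaRatio q = (hauptmodul q)⁻¹ := by
  have h := thetaA_mul_thetaB_pos hq0 hq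
  have hA : thetaA q ≠ 0 := left_ne_zero_of_mul h.ne'
  have hB : thetaB q ≠ 0 := right_ne_zero_of_mul h.ne'
  have hP := (eulerProd_pos hq0.le hq).ne'
  have hP5 := (eulerProd_pow_five_pos hq0.le hq).ne'
  have h1 := quintic_theta hq0 hq
  have h2 := thetaA_mul_thetaB hq0.ne' (by rwa [Real.norm_of_nonneg hq0.le])
  have e1 : (thetaRatio q)⁻¹ - 11 - thetaRatio q =
      (thetaA q ^ 10 - 11 * q * thetaA q ^ 5 * thetaB q ^ 5 - q ^ 2 * thetaB q ^ 10) /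
        (q * (thetaA q * thetaB q) ^ 5) := by
    rw [thetaRatio]
    field_simp
  rw [e1, eq_div_of_mul_eq hP5 h1, h2, hauptmodul]
  field_simp

lemma hasDerivAt_thetaRatio {q : ℝ} (hq0 : 0 < q) (hq : q < 1) :
    HasDerivAt thetaRatio (thetaRatio q * eulerProd q ^ 5 / (q * eulerProd (q ^ 5))) q := by
  have hn : ‖q‖ < 1 := by rwa [Real.norm_of_nonneg hq0.le]
  have h := thetaA_mul_thetaB_pos hq0 hq
  have hA : thetaA q ≠ 0 := left_ne_zero_of_mul h.ne'
  have hB : thetaB q ≠ 0 := right_ne_zero_of_mul h.ne'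
  have hP := (eulerProd_pos hq0.le hq).ne'
  have hP5 := (eulerProd_pow_five_pos hq0.le hq).ne'
  have h2 := thetaA_mul_thetaB hq0.ne' hn
  have hW := wronskian_theta hq0.ne' hn
  refine (((hasDerivAt_id q).mul ((hasDerivAt_thetaB hq0 hq).pow 5)).div
    ((hasDerivAt_thetaA hq0 hq).pow 5) (pow_ne_zero 5 hA)).congr_deriv ?_
  generalize ∑' n : ℤ, ((5 * tri n - n : ℤ) : ℝ) * termB q n = DB at *
  generalize ∑' m : ℤ, ((5 * tri m - 2 * m : ℤ) : ℝ) * termA q m = DA at *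
  have e : thetaRatio q * eulerProd q ^ 5 / (q * eulerProd (q ^ 5)) =
      thetaRatio q * (thetaA q * thetaB q + 5 * (thetaA q * DB - DA * thetaB q)) /
        (q * (thetaA q * thetaB q)) := by
    rw [hW, h2]
    field_simp
  rw [e, thetaRatio]
  simp only [Pi.mul_apply, Pi.pow_apply, id_eq]
  field_simp
  push_cast
  ring

lemma hasDerivAt_hauptmodul {q : ℝ} (hq0 : 0 < q) (hq : q < 1) :
    HasDerivAt hauptmodul (hauptmodul q * √(1 + 22 * hauptmodul q + 125 * hauptmodul q ^ 2) *
      eulerProd q ^ 5 / (q * eulerProd (q ^ 5))) q := by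
  have hx := thetaRatio_pos hq0 hq
  have ht := hauptmodul_pos hq0 hq
  have h := inv_thetaRatio_sub hq0 hq
  have hne : (thetaRatio q)⁻¹ - 11 - thetaRatio q ≠ 0 := by
    rw [h]
    exact (inv_pos.mpr ht).ne'
  have hd := ((((hasDerivAt_thetaRatio hq0 hq).inv hx.ne').sub_const 11).sub
    (hasDerivAt_thetaRatio hq0 hq)).inv hne
  have hR : √(1 + 22 * hauptmodul q + 125 * hauptmodul q ^ 2) =
      hauptmodul q * ((thetaRatio q)⁻¹ + thetaRatio q) := by
    have e1 : hauptmodul q * (hauptmodul q)⁻¹ = 1 := mul_inv_cancel₀ ht.ne'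
    have e2 : thetaRatio q * (thetaRatio q)⁻¹ = 1 := mul_inv_cancel₀ hx.ne'
    have e3 : hauptmodul q * (thetaRatio q)⁻¹ - 11 * hauptmodul q - hauptmodul q * thetaRatio q =
        1 := by linear_combination hauptmodul q * h + e1
    rw [← Real.sqrt_sq (mul_pos ht (add_pos (inv_pos.mpr hx) hx)).le]
    congr 1
    linear_combination (-(hauptmodul q * (thetaRatio q)⁻¹ - hauptmodul q * thetaRatio q +
      11 * hauptmodul q + 1)) * e3 - 4 * hauptmodul q ^ 2 * e2
  refine (hd.congr_of_eventuallyEq ?_).congr_deriv ?_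
  · filter_upwards [Ioo_mem_nhds hq0 hq] with y hy
    simp only [Pi.inv_apply, Pi.sub_apply]
    rw [inv_thetaRatio_sub hy.1 hy.2, inv_inv]
  · simp only [Pi.inv_apply, Pi.sub_apply]
    rw [h, hR]
    have hP5 := (eulerProd_pow_five_pos hq0.le hq).ne'
    field_simp
    ring

end Derivative

section Limits

lemma eulerProd_anti {x y : ℝ} (hx : 0 ≤ x) (hxy : x ≤ y) (hy : y < 1) :
    eulerProd y ≤ eulerProd x := by
  have hy0 := hx.trans hxy
  refine le_of_tendsto_of_tendsto' (tendsto_eulerPartial (by rwa [Real.norm_of_nonneg hy0]))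
    (tendsto_eulerPartial (by rw [Real.norm_of_nonneg hx]; exact hxy.trans_lt hy)) fun n ↦ ?_
  refine prod_le_prod (fun k _ ↦ sub_nonneg.mpr (pow_le_one₀ hy0 hy.le)) fun k _ ↦ ?_
  gcongr

lemma eulerProd_le_one {x : ℝ} (hx : 0 ≤ x) (hx1 : x < 1) : eulerProd x ≤ 1 := by
  refine (eulerProd_anti le_rfl hx hx1).trans_eq ?_
  simp [eulerProd]

lemma eulerProd_le_one_sub_mul {x : ℝ} (hx : 0 ≤ x) (hx1 : x < 1) :
    eulerProd x ≤ (1 - x) * eulerProd (x ^ 5) := by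
  have hn : ‖x‖ < 1 := by rwa [Real.norm_of_nonneg hx]
  refine le_of_tendsto_of_tendsto' ((tendsto_eulerPartial hn).comp (tendsto_add_atTop_nat 1))
    ((tendsto_eulerPartial (norm_pow_lt_one hn (show 5 ≠ 0 by norm_num))).const_mul (1 - x))
    fun n ↦ ?_
  rw [Function.comp_apply, eulerPartial, prod_range_succ', zero_add, pow_one, mul_comm]
  refine mul_le_mul_of_nonneg_left (prod_le_prod (fun k _ ↦ sub_nonneg.mpr (pow_le_one₀ hx hx1.le))
    fun k _ ↦ ?_) (sub_nonneg.mpr hx1.le)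
  rw [← pow_mul]
  exact sub_le_sub_left (pow_le_pow_of_le_one hx hx1.le (by omega)) 1

lemma tendsto_hauptmodul_zero : Tendsto hauptmodul (𝓝[>] 0) (𝓝 0) := by
  have h1 : Tendsto (fun q : ℝ ↦ q / eulerProd (1 / 2) ^ 6) (𝓝[>] 0) (𝓝 0) :=
    (Continuous.tendsto' (by fun_prop) 0 0 (by simp)).mono_left nhdsWithin_le_nhds
  have hmem : Set.Ioo (0 : ℝ) (1 / 2) ∈ 𝓝[>] (0 : ℝ) := Ioo_mem_nhdsGT (by norm_num)
  refine squeeze_zero' ?_ ?_ h1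
  · filter_upwards [hmem] with q hq
    exact (hauptmodul_pos hq.1 (hq.2.trans (by norm_num))).le
  · filter_upwards [hmem] with q hq
    have hq1 : q < 1 := hq.2.trans (by norm_num)
    have hP := eulerProd_pos (q := 1 / 2) (by norm_num) (by norm_num)
    have h5 := eulerProd_pow_five_pos hq.1.le hq1
    have h6 : eulerProd (q ^ 5) ^ 6 ≤ 1 := pow_le_one₀ h5.le
      (eulerProd_le_one (pow_nonneg hq.1.le 5) (pow_lt_one₀ hq.1.le hq1 (by norm_num)))
    have h7 := eulerProd_anti hq.1.le hq.2.le (by norm_num)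
    have := hq.1
    rw [hauptmodul]
    gcongr
    exact mul_le_of_le_one_right hq.1.le h6

lemma tendsto_hauptmodul_one : Tendsto hauptmodul (𝓝[<] 1) atTop := by
  have hmem : Set.Ioo (1 / 2 : ℝ) 1 ∈ 𝓝[<] (1 : ℝ) := Ioo_mem_nhdsLT (by norm_num)
  have h0 : Tendsto (fun q : ℝ ↦ 2 * (1 - q) ^ 6) (𝓝[<] 1) (𝓝[>] 0) := by
    refine tendsto_nhdsWithin_iff.mpr
      ⟨(Continuous.tendsto' (by fun_prop) 1 0 (by simp)).mono_left nhdsWithin_le_nhds, ?_⟩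
    filter_upwards [hmem] with q hq
    have : 0 < 1 - q := sub_pos.mpr hq.2
    exact Set.mem_Ioi.mpr (by positivity)
  refine tendsto_atTop_mono' _ ?_ h0.inv_tendsto_nhdsGT_zero
  filter_upwards [hmem] with q hq
  have hq0 : 0 < q := lt_trans (by norm_num) hq.1
  have hP := eulerProd_pos hq0.le hq.2
  have h1 := eulerProd_le_one_sub_mul hq0.le hq.2
  have h5 := eulerProd_pow_five_pos hq0.le hq.2
  have hs : 0 < 1 - q := sub_pos.mpr hq.2
  rw [Pi.inv_apply, hauptmodul, inv_le_iff_one_le_mul₀ (by positivity), div_mul_eq_mul_div,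
    one_le_div (by positivity)]
  calc eulerProd q ^ 6 ≤ ((1 - q) * eulerProd (q ^ 5)) ^ 6 := by gcongr
    _ = 1 / 2 * eulerProd (q ^ 5) ^ 6 * (2 * (1 - q) ^ 6) := by ring
    _ ≤ q * eulerProd (q ^ 5) ^ 6 * (2 * (1 - q) ^ 6) := by
      gcongr
      exact hq.1.le

end Limits

section Integration

/-- The fundamental theorem of calculus for a nonnegative derivative on an open interval, with
prescribed limits at the endpoints. -/
lemma integral_eq_sub_of_hasDerivAt_of_nonneg_of_tendsto {F f : ℝ → ℝ} {a b fa fb : ℝ}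
    (hab : a < b) (hd : ∀ x ∈ Set.Ioo a b, HasDerivAt F (f x) x)
    (hf : ∀ x ∈ Set.Ioo a b, 0 ≤ f x)
    (ha : Tendsto F (𝓝[>] a) (𝓝 fa)) (hb : Tendsto F (𝓝[<] b) (𝓝 fb)) :
    ∫ x in a..b, f x = fb - fa := by
  refine intervalIntegral.integral_eq_sub_of_hasDerivAt_of_tendsto hab hd ?_ ha hb
  have hc := continuousOn_Icc_extendFrom_Ioo
    (fun x hx ↦ (hd x hx).continuousAt.continuousWithinAt) ha hb
  rw [← Set.uIcc_of_le hab.le] at hc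
  refine intervalIntegral.intervalIntegrable_deriv_of_nonneg hc (fun x hx ↦ ?_) ?_
  · rw [min_eq_left hab.le, max_eq_right hab.le] at hx
    refine (hd x hx).congr_of_eventuallyEq ?_
    filter_upwards [Ioo_mem_nhds hx.1 hx.2] with y hy
    exact extendFrom_eq (subset_closure hy) (hd y hy).continuousAt.continuousWithinAt
  · rwa [min_eq_left hab.le, max_eq_right hab.le]

/-- The integrand of the elliptic integral of the first kind. -/
noncomputable def ellipticIntegrand (m θ : ℝ) : ℝ := (√(1 - m * Real.sin θ ^ 2))⁻¹

lemma continuous_ellipticIntegrand {m : ℝ} (hm : m < 1) : Continuous (ellipticIntegrand m) := by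
  refine Continuous.inv₀ (by fun_prop) fun θ ↦ (Real.sqrt_pos.mpr ?_).ne'
  have h1 := Real.sin_sq_le_one θ
  have h0 := sq_nonneg (Real.sin θ)
  rcases h0.eq_or_lt with h | h
  · rw [← h]
    norm_num
  · nlinarith [mul_pos h (sub_pos.mpr hm)]

lemma integral_ellipticIntegrand_pi {m : ℝ} (hm : m < 1) :
    ∫ θ in (0 : ℝ)..Real.pi, ellipticIntegrand m θ = 2 * ellipticK m := by
  have hc := continuous_ellipticIntegrand hm
  rw [← intervalIntegral.integral_add_adjacent_intervals (hc.intervalIntegrable 0 (Real.pi / 2))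
    (hc.intervalIntegrable _ _), two_mul]
  have h := intervalIntegral.integral_comp_sub_left (ellipticIntegrand m) Real.pi
    (a := 0) (b := Real.pi / 2)
  rw [sub_zero, sub_half] at h
  rw [← h]
  simp only [ellipticIntegrand, Real.sin_pi_sub]
  rfl

lemma ellipticIntegrand_two_arctan {m c t : ℝ} (hc : (2 - 4 * m) * c ^ 2 = 22) (hc4 : c ^ 4 = 125)
    (ht : 0 < t) : ellipticIntegrand m (2 * Real.arctan (c * √t)) =
      (1 + c ^ 2 * t) / √(1 + 22 * t + 125 * t ^ 2) := by
  have hs : √t ^ 2 = t := Real.sq_sqrt ht.le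
  have hp : 0 < 1 + c ^ 2 * t := by positivity
  have hy : 1 + (c * √t) ^ 2 = 1 + c ^ 2 * t := by rw [mul_pow, hs]
  have hsin : Real.sin (2 * Real.arctan (c * √t)) ^ 2 = 4 * (c ^ 2 * t) / (1 + c ^ 2 * t) ^ 2 := by
    rw [Real.sin_two_mul, Real.sin_arctan, Real.cos_arctan, hy, mul_pow, mul_pow, div_pow, div_pow,
      mul_pow, hs, Real.sq_sqrt hp.le]
    field_simp
    ring
  have h : 1 - m * Real.sin (2 * Real.arctan (c * √t)) ^ 2 =
      (1 + 22 * t + 125 * t ^ 2) / (1 + c ^ 2 * t) ^ 2 := by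
    rw [hsin]
    field_simp
    linear_combination t * hc + t ^ 2 * hc4
  rw [ellipticIntegrand, h, Real.sqrt_div (by positivity), Real.sqrt_sq hp.le, inv_div]

lemma sqrt_hauptmodul {q : ℝ} (hq0 : 0 < q) (hq : q < 1) :
    √(hauptmodul q) = √q * eulerProd (q ^ 5) ^ 3 / eulerProd q ^ 3 := by
  have hP := eulerProd_pos hq0.le hq
  have h5 := eulerProd_pow_five_pos hq0.le hq
  rw [Real.sqrt_eq_iff_mul_self_eq (hauptmodul_pos hq0 hq).le (by positivity), hauptmodul]
  have := Real.mul_self_sqrt hq0.le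
  field_simp
  linear_combination -this

lemma hasDerivAt_ellipticIntegral_hauptmodul {m c : ℝ} (hm : m < 1)
    (hc : (2 - 4 * m) * c ^ 2 = 22) (hc4 : c ^ 4 = 125) {q : ℝ} (hq0 : 0 < q) (hq : q < 1) :
    HasDerivAt
      (fun q ↦ ∫ θ in (0 : ℝ)..2 * Real.arctan (c * √(hauptmodul q)), ellipticIntegrand m θ)
      (c * (eulerProd (q ^ 5) ^ 2 * eulerProd q ^ 2 * q ^ (-(1 : ℝ) / 2))) q := by
  have ht := hauptmodul_pos hq0 hq
  have hφ := ((((hasDerivAt_hauptmodul hq0 hq).sqrt ht.ne').const_mul c).arctan).const_mul 2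
  have hG := ((continuous_ellipticIntegrand hm).integral_hasStrictDerivAt 0
    (2 * Real.arctan (c * √(hauptmodul q)))).hasDerivAt
  refine (hG.comp q hφ).congr_deriv ?_
  rw [ellipticIntegrand_two_arctan hc hc4 ht, mul_pow, Real.sq_sqrt ht.le]
  have hR : 0 < √(1 + 22 * hauptmodul q + 125 * hauptmodul q ^ 2) :=
    Real.sqrt_pos.mpr (by positivity)
  have hp : 0 < 1 + c ^ 2 * hauptmodul q := by positivity
  have hP := eulerProd_pos hq0.le hq
  have h5 := eulerProd_pow_five_pos hq0.le hq
  have hs : 0 < √q := Real.sqrt_pos.mpr hq0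
  have hst : 0 < √(hauptmodul q) := Real.sqrt_pos.mpr ht
  have hpow : q ^ (-(1 : ℝ) / 2) = (√q)⁻¹ := by
    rw [neg_div, Real.rpow_neg hq0.le, ← Real.sqrt_eq_rpow]
  have hdiv : hauptmodul q / √(hauptmodul q) = √(hauptmodul q) := Real.div_sqrt
  calc _ = c * (hauptmodul q / √(hauptmodul q)) * eulerProd q ^ 5 / (q * eulerProd (q ^ 5)) := by
        field_simp
    _ = _ := by
        rw [hdiv, sqrt_hauptmodul hq0 hq, hpow]
        field_simp
        rw [Real.sq_sqrt hq0.le]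

end Integration

theorem integral_f2f2 :
    ∫ q in (0:ℝ)..1, eulerF (q ^ 5) ^ 2 * eulerF q ^ 2 * q ^ (-(1 : ℝ) / 2) =
      (2 / (5 : ℝ) ^ ((3 : ℝ) / 4)) * ellipticK (1 / 2 - 11 / (10 * Real.sqrt 5)) := by
  set m : ℝ := 1 / 2 - 11 / (10 * Real.sqrt 5) with hm_def
  set c : ℝ := (5 : ℝ) ^ ((3 : ℝ) / 4) with hc_def
  have hs5 : (0 : ℝ) < √5 := by positivity
  have hm : m < 1 := by
    have : 0 < 11 / (10 * √5) := by positivity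
    linarith
  have hc0 : 0 < c := by positivity
  have hc2 : c ^ 2 = 5 * √5 := by
    rw [hc_def, ← Real.rpow_natCast, ← Real.rpow_mul (by norm_num), Real.sqrt_eq_rpow,
      ← Real.rpow_one_add' (by norm_num) (by norm_num)]
    norm_num
  have hc : (2 - 4 * m) * c ^ 2 = 22 := by
    rw [hc2, hm_def]
    field_simp
    ring
  have hc4 : c ^ 4 = 125 := by
    rw [show c ^ 4 = (c ^ 2) ^ 2 by ring, hc2, mul_pow, Real.sq_sqrt (by norm_num)]
    norm_num
  have hG : Continuous fun φ : ℝ ↦ ∫ θ in (0 : ℝ)..φ, ellipticIntegrand m θ :=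
    intervalIntegral.continuous_primitive
      (fun a b ↦ (continuous_ellipticIntegrand hm).intervalIntegrable a b) 0
  have h0 : Tendsto (fun q : ℝ ↦ 2 * Real.arctan (c * √(hauptmodul q))) (𝓝[>] 0) (𝓝 0) := by
    have h : Continuous fun t : ℝ ↦ 2 * Real.arctan (c * √t) := by fun_prop
    exact (h.tendsto' 0 0 (by simp)).comp tendsto_hauptmodul_zero
  have h1 : Tendsto (fun q : ℝ ↦ 2 * Real.arctan (c * √(hauptmodul q))) (𝓝[<] 1)
      (𝓝 Real.pi) := by
    have h := ((tendsto_nhds_of_tendsto_nhdsWithin Real.tendsto_arctan_atTop).comp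
      ((Real.tendsto_sqrt_atTop.comp tendsto_hauptmodul_one).const_mul_atTop hc0)).const_mul 2
    rwa [mul_div_cancel₀ _ (two_ne_zero)] at h
  have key := integral_eq_sub_of_hasDerivAt_of_nonneg_of_tendsto zero_lt_one
    (fun q hq ↦ hasDerivAt_ellipticIntegral_hauptmodul hm hc hc4 hq.1 hq.2)
    (fun q hq ↦ by have := hq.1; positivity)
    ((hG.tendsto 0).comp h0) ((hG.tendsto Real.pi).comp h1)
  rw [intervalIntegral.integral_same, sub_zero, integral_ellipticIntegrand_pi hm,
    intervalIntegral.integral_const_mul] at key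
  change ∫ q in (0 : ℝ)..1, eulerProd (q ^ 5) ^ 2 * eulerProd q ^ 2 * q ^ (-(1 : ℝ) / 2) = _
  rw [div_mul_eq_mul_div, eq_div_iff hc0.ne', mul_comm]
  exact key
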